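/- arXiv:2409.14408 — 3 statements merged into one kernel-verified Lean document; each statement's English description precedes it below -/
import Mathlib

section
/- Let μ be a finite Borel measure on ℝ whose support is contained in the interval (0, 1]. Then the iterated lower Lebesgue integral ∫₀^∞ ( ∫ ENNReal.ofReal(−f(λ, t)) dμ(λ) ) dt equals ∫ ENNReal.ofReal(−log λ) dμ(λ), as an equality in the extended nonnegative reals (both sides may be infinite). -/
open MeasureTheory

/-- `f(λ, t) = −((t+1)⁻¹ − λ(t+λ)⁻¹)/t = (λ−1)/((t+1)(t+λ))`. -/
noncomputable def f (lam t : ℝ) : ℝ := (lam - 1) / ((t + 1) * (t + lam))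

theorem neg_f_nonneg {lam t : ℝ} (h0 : 0 < lam) (h1 : lam ≤ 1) (ht : 0 < t) :
    0 ≤ -(f lam t) := by
  rw [f, ← neg_div]
  exact div_nonneg (by linarith) (by positivity)

theorem hasDerivAt_log_add_sub_log_add_one {lam t : ℝ} (h0 : 0 < lam) (ht : 0 ≤ t) :
    HasDerivAt (fun s => Real.log (s + lam) - Real.log (s + 1)) (-(f lam t)) t := by
  have hlam : t + lam ≠ 0 := by positivity
  have hone : t + 1 ≠ 0 := by positivity
  have h := (((hasDerivAt_id t).add_const lam).log hlam).sub
    (((hasDerivAt_id t).add_const 1).log hone)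
  refine h.congr_deriv ?_
  simp only [f, id]
  field_simp
  ring

theorem tendsto_log_add_sub_log_add_atTop (a b : ℝ) :
    Filter.Tendsto (fun s => Real.log (s + a) - Real.log (s + b)) Filter.atTop (nhds 0) := by
  simpa using (Real.tendsto_log_comp_add_sub_log a).sub (Real.tendsto_log_comp_add_sub_log b)

/-- `∫₀^∞ −f(λ, t) dt = −log λ` for `0 < λ ≤ 1`. -/
theorem lintegral_ofReal_neg_f {lam : ℝ} (h0 : 0 < lam) (h1 : lam ≤ 1) :
    ∫⁻ t in Set.Ioi (0 : ℝ), ENNReal.ofReal (-(f lam t)) = ENNReal.ofReal (-Real.log lam) := by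
  have hderiv : ∀ t ∈ Set.Ici (0 : ℝ), HasDerivAt
      (fun s => Real.log (s + lam) - Real.log (s + 1)) (-(f lam t)) t :=
    fun t ht => hasDerivAt_log_add_sub_log_add_one h0 ht
  have hnonneg : ∀ t ∈ Set.Ioi (0 : ℝ), 0 ≤ -(f lam t) := fun t ht => neg_f_nonneg h0 h1 ht
  have hlim := tendsto_log_add_sub_log_add_atTop lam 1
  rw [← ofReal_integral_eq_lintegral_ofReal (integrableOn_Ioi_deriv_of_nonneg' hderiv hnonneg hlim)
    (ae_restrict_of_forall_mem measurableSet_Ioi hnonneg),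
    integral_Ioi_of_hasDerivAt_of_nonneg' hderiv hnonneg hlim]
  simp

/-- If `μ` is a finite Borel measure on `ℝ` supported in `(0, 1]`, then
`∫₀^∞ (∫ (−f(λ, t))⁺ dμ(λ)) dt = ∫ (−log λ)⁺ dμ(λ)` as lower Lebesgue integrals in `ℝ≥0∞`. -/
theorem lintegral_lintegral_neg_f_eq_lintegral_neg_log (μ : Measure ℝ) [IsFiniteMeasure μ]
    (hsupp : μ (Set.Ioc (0 : ℝ) 1)ᶜ = 0) :
    ∫⁻ t in Set.Ioi (0 : ℝ), (∫⁻ lam, ENNReal.ofReal (-(f lam t)) ∂μ) =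
      ∫⁻ lam, ENNReal.ofReal (-Real.log lam) ∂μ := by
  have hmeas : Measurable (Function.uncurry fun t lam : ℝ => ENNReal.ofReal (-(f lam t))) := by
    unfold f Function.uncurry
    fun_prop
  rw [lintegral_lintegral_swap hmeas.aemeasurable]
  have hae : ∀ᵐ lam ∂μ, lam ∈ Set.Ioc (0 : ℝ) 1 := hsupp
  exact lintegral_congr_ae (hae.mono fun lam h => lintegral_ofReal_neg_f h.1 h.2)
end

section
/- Let μ be a finite Borel measure on ℝ whose support is contained in the interval [1, ∞). Then the iterated lower Lebesgue integral ∫₀^∞ ( ∫ ENNReal.ofReal(f(λ, t)) dμ(λ) ) dt equals ∫ ENNReal.ofReal(log λ) dμ(λ), as an equality in the extended nonnegative reals (both sides may be infinite). -/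
open MeasureTheory

theorem measurable_uncurry_f : Measurable (Function.uncurry f) := by
  unfold f Function.uncurry
  fun_prop

theorem f_nonneg {lam t : ℝ} (hlam : 1 ≤ lam) (ht : 0 ≤ t) : 0 ≤ f lam t :=
  div_nonneg (by linarith) (mul_nonneg (by linarith) (by linarith))

theorem hasDerivAt_log_add_one_sub_log_add {lam t : ℝ} (hlam : 1 ≤ lam) (ht : 0 ≤ t) :
    HasDerivAt (fun t => Real.log (t + 1) - Real.log (t + lam)) (f lam t) t := by
  have h1 : t + 1 ≠ 0 := by linarith
  have h2 : t + lam ≠ 0 := by linarith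
  refine ((((hasDerivAt_id' t).add_const 1).log h1).sub
    (((hasDerivAt_id' t).add_const lam).log h2)).congr_deriv ?_
  unfold f
  field_simp
  ring

theorem tendsto_log_add_one_sub_log_add {lam : ℝ} (hlam : 1 ≤ lam) :
    Filter.Tendsto (fun t => Real.log (t + 1) - Real.log (t + lam)) Filter.atTop (nhds 0) := by
  have hinv : Filter.Tendsto (fun t : ℝ => 1 - (lam - 1) * (t + lam)⁻¹) Filter.atTop (nhds 1) := by
    simpa using ((Filter.tendsto_atTop_add_const_right _ lam
      Filter.tendsto_id).inv_tendsto_atTop.const_mul (lam - 1)).const_sub 1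
  have hlog := hinv.log one_ne_zero
  rw [Real.log_one] at hlog
  refine hlog.congr' ?_
  filter_upwards [Filter.eventually_ge_atTop 0] with t ht
  have h1 : t + 1 ≠ 0 := by linarith
  have h2 : t + lam ≠ 0 := by linarith
  rw [← Real.log_div h1 h2]
  congr 1
  field_simp
  ring

theorem lintegral_Ioi_f {lam : ℝ} (hlam : 1 ≤ lam) :
    ∫⁻ t in Set.Ioi (0 : ℝ), ENNReal.ofReal (f lam t) = ENNReal.ofReal (Real.log lam) := by
  have hderiv : ∀ t ∈ Set.Ici (0 : ℝ),
      HasDerivAt (fun t => Real.log (t + 1) - Real.log (t + lam)) (f lam t) t :=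
    fun t ht => hasDerivAt_log_add_one_sub_log_add hlam ht
  have hpos : ∀ t ∈ Set.Ioi (0 : ℝ), 0 ≤ f lam t := fun t ht => f_nonneg hlam (le_of_lt ht)
  have hlim := tendsto_log_add_one_sub_log_add hlam
  rw [← ofReal_integral_eq_lintegral_ofReal (integrableOn_Ioi_deriv_of_nonneg' hderiv hpos hlim)
    (ae_restrict_of_forall_mem measurableSet_Ioi hpos),
    integral_Ioi_of_hasDerivAt_of_nonneg' hderiv hpos hlim]
  simp

/-- If `μ` is a finite Borel measure on `ℝ` supported in `[1, ∞)`, then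
`∫₀^∞ (∫ f(λ, t)⁺ dμ(λ)) dt = ∫ (log λ)⁺ dμ(λ)` as lower Lebesgue integrals in `ℝ≥0∞`. -/
theorem lintegral_lintegral_f_eq_lintegral_log (μ : Measure ℝ) [IsFiniteMeasure μ]
    (hsupp : μ (Set.Ici (1 : ℝ))ᶜ = 0) :
    ∫⁻ t in Set.Ioi (0 : ℝ), (∫⁻ lam, ENNReal.ofReal (f lam t) ∂μ) =
      ∫⁻ lam, ENNReal.ofReal (Real.log lam) ∂μ := by
  rw [lintegral_lintegral_swap
    (measurable_uncurry_f.comp measurable_swap).ennreal_ofReal.aemeasurable]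
  refine lintegral_congr_ae ?_
  filter_upwards [mem_ae_iff.mpr hsupp] with lam hlam
  exact lintegral_Ioi_f hlam
end

section
/- Let μ be a finite Borel measure on ℝ supported in (0, ∞) such that λ ↦ log λ is μ-integrable and λ ↦ λ^{t₀} is μ-integrable for some t₀ > 0. Then the difference quotient t ↦ ( ∫ λ^t dμ(λ) − μ(ℝ) ) / t tends to ∫ log λ dμ(λ) as t → 0⁺ (limit along the filter of positive reals tending to 0). -/
open MeasureTheory Filter

/-- The difference quotient of `t ↦ x ^ t` at `0` tends to `log x` from the right. -/
theorem tendsto_rpow_sub_one_div {x : ℝ} (hx : 0 < x) :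
    Tendsto (fun t : ℝ => (x ^ t - 1) / t) (nhdsWithin 0 (Set.Ioi 0)) (nhds (Real.log x)) := by
  have h := (Real.hasStrictDerivAt_const_rpow hx 0).hasDerivAt.tendsto_slope_zero_right
  simpa [div_eq_inv_mul] using h

theorem log_le_rpow_sub_one_div {x t : ℝ} (hx : 0 < x) (ht : 0 < t) :
    Real.log x ≤ (x ^ t - 1) / t := by
  rw [le_div_iff₀ ht, Real.rpow_def_of_pos hx]
  linarith [Real.add_one_le_exp (Real.log x * t)]

theorem rpow_sub_one_div_le {x s t : ℝ} (hx : 0 < x) (hs : 0 < s) (hst : s ≤ t) :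
    (x ^ s - 1) / s ≤ (x ^ t - 1) / t := by
  have ht : 0 < t := hs.trans_le hst
  have h := rpow_one_add_le_one_add_mul_self (s := x ^ t - 1)
    (by linarith [Real.rpow_pos_of_pos hx t]) (div_nonneg hs.le ht.le) ((div_le_one ht).2 hst)
  rw [add_sub_cancel, ← Real.rpow_mul hx.le, mul_div_cancel₀ _ ht.ne'] at h
  rw [div_le_iff₀ hs]
  calc x ^ s - 1 ≤ s / t * (x ^ t - 1) := by linarith
    _ = (x ^ t - 1) / t * s := by ring

/-- If `μ` is a finite Borel measure on `ℝ` supported in `(0, ∞)`, with `log` μ-integrable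
and `λ ↦ λ^t₀` μ-integrable for some `t₀ > 0`, then
`(∫ λ^t dμ(λ) − μ(ℝ))/t → ∫ log λ dμ(λ)` as `t → 0⁺`. -/
theorem tendsto_diffquot_integral_rpow (μ : Measure ℝ) [IsFiniteMeasure μ]
    (hsupp : μ (Set.Ioi (0 : ℝ))ᶜ = 0)
    (hlog : Integrable (fun lam => Real.log lam) μ)
    (t₀ : ℝ) (ht₀ : 0 < t₀) (hpow : Integrable (fun lam => lam ^ t₀) μ) :
    Tendsto (fun t : ℝ => ((∫ lam, lam ^ t ∂μ) - (μ Set.univ).toReal) / t)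
      (nhdsWithin 0 (Set.Ioi 0)) (nhds (∫ lam, Real.log lam ∂μ)) := by
  have hpos : ∀ᵐ x ∂μ, 0 < x := by
    filter_upwards [mem_ae_iff.2 hsupp] with x hx using hx
  let bound : ℝ → ℝ := fun x => |Real.log x| + |(x ^ t₀ - 1) / t₀|
  have hbound_int : Integrable bound μ :=
    hlog.abs.add ((hpow.sub (integrable_const 1)).div_const t₀).abs
  have hmeas (t : ℝ) : AEStronglyMeasurable (fun x : ℝ => (x ^ t - 1) / t) μ :=
    (((measurable_id.pow_const t).sub_const 1).div_const t).aestronglyMeasurable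
  have hsmall : ∀ᶠ t : ℝ in nhdsWithin 0 (Set.Ioi 0), t ∈ Set.Ioc 0 t₀ :=
    Ioc_mem_nhdsGT ht₀
  have hbound : ∀ t ∈ Set.Ioc 0 t₀, ∀ᵐ x ∂μ, ‖(x ^ t - 1) / t‖ ≤ bound x := by
    intro t ht
    filter_upwards [hpos] with x hx
    have hl := log_le_rpow_sub_one_div hx ht.1
    have hu := rpow_sub_one_div_le hx ht.1 ht.2
    rw [Real.norm_eq_abs, abs_le]
    constructor <;> dsimp only [bound]
    · linarith [neg_abs_le (Real.log x), abs_nonneg ((x ^ t₀ - 1) / t₀)]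
    · linarith [abs_nonneg (Real.log x), le_abs_self ((x ^ t₀ - 1) / t₀)]
  have hlim : Tendsto (fun t : ℝ => ∫ x, (x ^ t - 1) / t ∂μ) (nhdsWithin 0 (Set.Ioi 0))
      (nhds (∫ x, Real.log x ∂μ)) := by
    refine tendsto_integral_filter_of_dominated_convergence bound (.of_forall hmeas)
      (hsmall.mono hbound) hbound_int ?_
    filter_upwards [hpos] with x hx using tendsto_rpow_sub_one_div hx
  refine hlim.congr' ?_
  filter_upwards [hsmall] with t ht
  have hquot : Integrable (fun x : ℝ => (x ^ t - 1) / t) μ :=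
    hbound_int.mono' (hmeas t) (hbound t ht)
  have hint : Integrable (fun x : ℝ => x ^ t) μ := by
    refine ((hquot.mul_const t).add (integrable_const 1)).congr (.of_forall fun x => ?_)
    simp [div_mul_cancel₀ _ ht.1.ne']
  rw [integral_div, integral_sub hint (integrable_const 1)]
  simp [Measure.real]
end
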